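/- Fix T > 0 and λ > 0. Let (T_i)_{i≥1} be the arrival times of a homogeneous Poisson process of rate λ on [0,T] with N = N(T) = #{i : T_i ≤ T}. Let (ω_i)_{i≥1} be i.i.d. real random variables, distributed as ω, independent of the Poisson process and of (X_i), satisfying E[exp(p·ω₋·T)] < ∞ for some p > α, where ω₋ = max(−ω,0). Let (X_i)_{i≥1} be identically distributed nonnegative random variables, independent of everything else, such that X₁ is regularly varying with index α > 0 and the family is uniformly asymptotically independent. Define the finite-time ruin probability ψ(x,T) = P( max{ max_{1≤k≤N} ∑_{j=1}^k X_j e^{−ω_j(T_k−T_j)} , ∑_{j=1}^N X_j e^{−ω_j(T−T_j)} } > x ). Then lim_{x→∞} ψ(x,T)/P(X₁ > x) = λ · ( T · P(ω > 0) + E[ ((1 − e^{−αωT})/(αω)) · 1_{ω ≤ 0} ] ), where (1 − e^{−αωT})/(αω) is interpreted as T when ω = 0. -/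

import Mathlib

open MeasureTheory ProbabilityTheory Filter

/-- First-order asymptotics of the probability of a finite union of asymptotically disjoint
events. -/
lemma tendsto_measureReal_biUnion_div {Ω ι : Type*} [MeasurableSpace Ω] (P : Measure Ω)
    [IsFiniteMeasure P] {F : ℝ → ℝ} (hF : ∀ x, 0 ≤ F x) (A : ι → ℝ → Set Ω)
    (hA : ∀ i x, MeasurableSet (A i x)) (a : ι → ℝ) (s : Finset ι)
    (h1 : ∀ i ∈ s, Tendsto (fun x => P.real (A i x) / F x) atTop (nhds (a i)))
    (h2 : ∀ i ∈ s, ∀ j ∈ s, i ≠ j →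
      Tendsto (fun x => P.real (A i x ∩ A j x) / F x) atTop (nhds 0)) :
    Tendsto (fun x => P.real (⋃ i ∈ s, A i x) / F x) atTop (nhds (∑ i ∈ s, a i)) := by
  classical
  induction s using Finset.induction_on with
  | empty => simp
  | insert i s his ih =>
    have ih' := ih (fun j hj => h1 j (Finset.mem_insert_of_mem hj))
      (fun j hj k hk => h2 j (Finset.mem_insert_of_mem hj) k (Finset.mem_insert_of_mem hk))
    have hi := h1 i (Finset.mem_insert_self i s)
    have hinter : Tendsto (fun x => P.real (A i x ∩ ⋃ j ∈ s, A j x) / F x) atTop (nhds 0) := by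
      have hsum : Tendsto (fun x => ∑ j ∈ s, P.real (A i x ∩ A j x) / F x) atTop (nhds 0) := by
        rw [← Finset.sum_const_zero (s := s)]
        refine tendsto_finsetSum _ fun j hj => ?_
        exact h2 i (Finset.mem_insert_self i s) j (Finset.mem_insert_of_mem hj)
          (fun h => his (h ▸ hj))
      refine squeeze_zero (fun x => div_nonneg measureReal_nonneg (hF x)) (fun x => ?_) hsum
      rw [← Finset.sum_div, Set.inter_iUnion₂]
      exact div_le_div_of_nonneg_right (measureReal_biUnion_finset_le _ _) (hF x)
    have := (hi.add ih').sub hinter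
    rw [Finset.sum_insert his]
    rw [sub_zero] at this
    refine this.congr fun x => ?_
    have hm : MeasurableSet (⋃ j ∈ s, A j x) := Finset.measurableSet_biUnion _ fun j _ => hA j x
    rw [Finset.set_biUnion_insert, ← add_div, ← sub_div]
    congr 1
    have := measureReal_union_add_inter (μ := P) (s := A i x) hm (measure_ne_top _ _)
      (measure_ne_top _ _)
    linarith

/-- A Potter-type bound: a regularly varying tail of index `α` satisfies
`F (x / t) ≤ C t ^ p F x` for `t ≥ 1` and all large `x`, whenever `p > α`. -/
lemma exists_potter_bound {F : ℝ → ℝ} (hpos : ∀ x, 0 < x → 0 < F x) (hF1 : ∀ x, F x ≤ 1)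
    (hanti : Antitone F) {α p : ℝ} (hα : 0 < α) (hp : α < p)
    (hRV : Tendsto (fun x => F (2 * x) / F x) atTop (nhds ((2 : ℝ) ^ (-α)))) :
    ∃ C : ℝ, 0 < C ∧ ∃ x₀ : ℝ, 0 < x₀ ∧ ∀ x ≥ x₀, ∀ t ≥ (1 : ℝ), F (x / t) ≤ C * t ^ p * F x := by
  have hlt : (2 : ℝ) ^ (-p) < 2 ^ (-α) := Real.rpow_lt_rpow_of_exponent_lt (by norm_num) (by linarith)
  obtain ⟨x₁, hx₁⟩ := eventually_atTop.1 (hRV.eventually_const_lt hlt)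
  set x₀ := max x₁ 1 with hx₀
  have hx₀pos : 0 < x₀ := lt_of_lt_of_le one_pos (le_max_right _ _)
  have hp0 : 0 < p := hα.trans hp
  have hdouble : ∀ y ≥ x₀, F y ≤ 2 ^ p * F (2 * y) := by
    intro y hy
    have hy0 : 0 < y := hx₀pos.trans_le hy
    have h := hx₁ y ((le_max_left _ _).trans hy)
    rw [lt_div_iff₀ (hpos y hy0), Real.rpow_neg (by norm_num)] at h
    have h2 : (0 : ℝ) < 2 ^ p := by positivity
    rw [inv_mul_lt_iff₀ h2] at h
    exact h.le
  have hpow : ∀ m : ℕ, ∀ y ≥ x₀, F y ≤ ((2 : ℝ) ^ m) ^ p * F (2 ^ m * y) := by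
    intro m
    induction m with
    | zero => intro y _; simp
    | succ m ih =>
      intro y hy
      have hy0 : 0 < y := hx₀pos.trans_le hy
      have h1 := hdouble (2 ^ m * y)
        (hy.trans (le_mul_of_one_le_left hy0.le (one_le_pow₀ (by norm_num))))
      calc F y ≤ ((2 : ℝ) ^ m) ^ p * F (2 ^ m * y) := ih y hy
        _ ≤ ((2 : ℝ) ^ m) ^ p * (2 ^ p * F (2 * (2 ^ m * y))) := by gcongr
        _ = ((2 : ℝ) ^ (m + 1)) ^ p * F (2 ^ (m + 1) * y) := by
          rw [pow_succ, Real.mul_rpow (by positivity) (by positivity)]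
          ring_nf
  have hlarge : ∀ t ≥ (1 : ℝ), ∀ y ≥ x₀, F y ≤ (2 * t) ^ p * F (t * y) := by
    intro t ht y hy
    have hy0 : 0 < y := hx₀pos.trans_le hy
    obtain ⟨m, hm1, hm2⟩ := exists_nat_pow_near ht (by norm_num : (1 : ℝ) < 2)
    calc F y ≤ ((2 : ℝ) ^ (m + 1)) ^ p * F (2 ^ (m + 1) * y) := hpow _ y hy
      _ ≤ (2 * t) ^ p * F (t * y) := by
        have h1 : (2 : ℝ) ^ (m + 1) ≤ 2 * t := by rw [pow_succ]; linarith
        have h2 : F (2 ^ (m + 1) * y) ≤ F (t * y) := hanti (by gcongr)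
        have h3 : 0 ≤ F (2 ^ (m + 1) * y) := (hpos _ (by positivity)).le
        gcongr
  have hF0 := hpos x₀ hx₀pos
  refine ⟨2 ^ p / F x₀, by positivity, x₀, hx₀pos, fun x hx t ht => ?_⟩
  have hx0 : 0 < x := hx₀pos.trans_le hx
  have ht0 : 0 < t := one_pos.trans_le ht
  have hFx := hpos x hx0
  rcases le_total x₀ (x / t) with h | h
  · have h1 := hlarge t ht (x / t) h
    rw [mul_div_cancel₀ _ ht0.ne', Real.mul_rpow (by norm_num) ht0.le] at h1
    refine h1.trans ?_
    gcongr
    rw [le_div_iff₀ hF0]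
    exact mul_le_of_le_one_right (by positivity) (hF1 _)
  · have h1 := hlarge (x / x₀) ((one_le_div hx₀pos).2 hx) x₀ le_rfl
    rw [div_mul_cancel₀ _ hx₀pos.ne'] at h1
    have h2 : x / x₀ ≤ t := by
      rw [div_le_iff₀ ht0] at h
      rw [div_le_iff₀ hx₀pos]; linarith
    have h3 : F x₀ ≤ 2 ^ p * t ^ p * F x := by
      rw [← Real.mul_rpow (by norm_num) ht0.le]
      refine h1.trans ?_
      gcongr
    calc F (x / t) ≤ 1 := hF1 _
      _ = F x₀ / F x₀ := (div_self hF0.ne').symm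
      _ ≤ 2 ^ p * t ^ p * F x / F x₀ := by gcongr
      _ = 2 ^ p / F x₀ * t ^ p * F x := by ring

/-- If a sum of `n` real numbers exceeds `x > 0`, then either one summand exceeds
`(1 - δ) x`, or two of them exceed `δ x / n`. -/
lemma exists_large_of_lt_sum {ι : Type*} (s : Finset ι) (y : ι → ℝ) {x δ : ℝ} (hx : 0 < x)
    (hδ0 : 0 ≤ δ) (hδ1 : δ ≤ 1) (h : x < ∑ j ∈ s, y j) :
    (∃ j ∈ s, (1 - δ) * x < y j) ∨
      ∃ i ∈ s, ∃ j ∈ s, i ≠ j ∧ δ / s.card * x < y i ∧ δ / s.card * x < y j := by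
  classical
  have hs : s.Nonempty := by
    rw [Finset.nonempty_iff_ne_empty]; rintro rfl; simp at h; linarith
  have hn : (0 : ℝ) < s.card := by exact_mod_cast hs.card_pos
  by_contra! hcon
  obtain ⟨h1, h2⟩ := hcon
  obtain ⟨i, hi, hlt⟩ : ∃ i ∈ s, x / s.card < y i := by
    refine Finset.exists_lt_of_sum_lt (f := fun _ => x / s.card) ?_
    rw [Finset.sum_const, nsmul_eq_mul, mul_div_cancel₀ _ hn.ne']
    exact h
  have hδi : δ / s.card * x < y i := by
    refine lt_of_le_of_lt ?_ hlt
    rw [div_mul_eq_mul_div]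
    gcongr
    nlinarith
  have hrest : ∑ j ∈ s.erase i, y j ≤ δ * x := by
    calc ∑ j ∈ s.erase i, y j ≤ ∑ j ∈ s.erase i, δ / s.card * x := by
          refine Finset.sum_le_sum fun j hj => ?_
          exact h2 i hi j (Finset.mem_of_mem_erase hj) (Finset.ne_of_mem_erase hj).symm hδi
      _ = (s.erase i).card * (δ / s.card * x) := by rw [Finset.sum_const, nsmul_eq_mul]
      _ ≤ s.card * (δ / s.card * x) := by
          have : ((s.erase i).card : ℝ) ≤ s.card := by
            exact_mod_cast Finset.card_le_card (Finset.erase_subset _ _)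
          gcongr
      _ = δ * x := by field_simp
  have := h1 i hi
  rw [← Finset.add_sum_erase s y hi] at h
  linarith

/-- The variables `X i`, `i ≥ 1`, are nonnegative, identically distributed with a regularly varying
tail of index `α`, and uniformly asymptotically independent. -/
structure IsUAIRegVarying {Ω : Type*} [MeasurableSpace Ω] (P : Measure Ω) (X : ℕ → Ω → ℝ)
    (α : ℝ) : Prop where
  measurable : ∀ i, Measurable (X i)
  nonneg : ∀ i ω, 0 ≤ X i ω
  identDistrib : ∀ i, 1 ≤ i → IdentDistrib (X i) (X 1) P P
  index_pos : 0 < α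
  tail_pos : ∀ x : ℝ, 0 < x → 0 < P.real {ω | x < X 1 ω}
  regVarying : ∀ t : ℝ, 0 < t →
    Tendsto (fun x => P.real {ω | t * x < X 1 ω} / P.real {ω | x < X 1 ω}) atTop (nhds (t ^ (-α)))
  uai : ∀ ε : ℝ, 0 < ε → ∃ x₀ : ℝ, ∀ x ≥ x₀, ∀ i j : ℕ, 1 ≤ i → 1 ≤ j → i ≠ j →
    P.real {ω | x < X i ω ∧ x < X j ω} ≤ ε * P.real {ω | x < X 1 ω}

namespace IsUAIRegVarying

variable {Ω : Type*} [MeasurableSpace Ω] {P : Measure Ω}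
  {X : ℕ → Ω → ℝ} {α : ℝ}

lemma measureReal_tail_eq (h : IsUAIRegVarying P X α) {i : ℕ} (hi : 1 ≤ i) (x : ℝ) :
    P.real {ω | x < X i ω} = P.real {ω | x < X 1 ω} := by
  have := (h.identDistrib i hi).measure_mem_eq (s := Set.Ioi x) measurableSet_Ioi
  exact congrArg ENNReal.toReal this

lemma measurableSet_lt_mul (h : IsUAIRegVarying P X α) (θ : ℝ) (i : ℕ) (x : ℝ) :
    MeasurableSet {ω | x < θ * X i ω} :=
  measurableSet_lt measurable_const ((h.measurable i).const_mul θ)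

lemma measureReal_lt_mul (h : IsUAIRegVarying P X α) {i : ℕ} (hi : 1 ≤ i) {θ : ℝ} (hθ : 0 < θ)
    (x : ℝ) : P.real {ω | x < θ * X i ω} = P.real {ω | x / θ < X 1 ω} := by
  rw [← h.measureReal_tail_eq hi]
  congr 1
  ext ω
  simp only [Set.mem_ofPred_eq]
  rw [div_lt_iff₀' hθ]

lemma tendsto_lt_mul (h : IsUAIRegVarying P X α) {i : ℕ} (hi : 1 ≤ i) {θ : ℝ} (hθ : 0 < θ) :
    Tendsto (fun x => P.real {ω | x < θ * X i ω} / P.real {ω | x < X 1 ω}) atTop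
      (nhds (θ ^ α)) := by
  have := h.regVarying θ⁻¹ (inv_pos.2 hθ)
  rw [Real.rpow_neg (inv_pos.2 hθ).le, Real.inv_rpow hθ.le, inv_inv] at this
  refine this.congr fun x => ?_
  rw [h.measureReal_lt_mul hi hθ, div_eq_inv_mul x]

lemma tendsto_uai (h : IsUAIRegVarying P X α) {i j : ℕ} (hi : 1 ≤ i) (hj : 1 ≤ j) (hij : i ≠ j) :
    Tendsto (fun x => P.real {ω | x < X i ω ∧ x < X j ω} / P.real {ω | x < X 1 ω}) atTop
      (nhds 0) := by
  rw [Metric.tendsto_atTop]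
  intro ε hε
  obtain ⟨x₀, hx₀⟩ := h.uai (ε / 2) (half_pos hε)
  refine ⟨max x₀ 1, fun x hx => ?_⟩
  have hF := h.tail_pos x (one_pos.trans_le ((le_max_right _ _).trans hx))
  rw [Real.dist_0_eq_abs, abs_of_nonneg (div_nonneg measureReal_nonneg hF.le)]
  refine lt_of_le_of_lt ?_ (half_lt_self hε)
  rw [div_le_iff₀ hF]
  exact hx₀ x ((le_max_left _ _).trans hx) i j hi hj hij

variable [IsProbabilityMeasure P]

lemma tendsto_inter_lt_mul (h : IsUAIRegVarying P X α) {i j : ℕ} (hi : 1 ≤ i) (hj : 1 ≤ j)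
    (hij : i ≠ j) {c d : ℝ} (hc : 0 < c) :
    Tendsto (fun x => P.real ({ω | x < c * X i ω} ∩ {ω | x < d * X j ω}) /
      P.real {ω | x < X 1 ω}) atTop (nhds 0) := by
  set m := max c d with hm
  have hm0 : 0 < m := hc.trans_le (le_max_left _ _)
  have h1 : Tendsto (fun x : ℝ => m⁻¹ * x) atTop atTop :=
    tendsto_id.const_mul_atTop (inv_pos.2 hm0)
  have h2 := ((h.tendsto_uai hi hj hij).comp h1).mul (h.regVarying m⁻¹ (inv_pos.2 hm0))
  rw [zero_mul] at h2
  refine squeeze_zero' (Eventually.of_forall fun x =>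
    div_nonneg measureReal_nonneg measureReal_nonneg) ?_ h2
  filter_upwards [eventually_gt_atTop 0] with x hx
  have hF := h.tail_pos (m⁻¹ * x) (by positivity)
  simp only [Function.comp_apply]
  rw [div_mul_div_cancel₀ hF.ne']
  refine div_le_div_of_nonneg_right (measureReal_mono ?_) measureReal_nonneg
  rintro ω ⟨h3, h4⟩
  simp only [Set.mem_ofPred_eq] at h3 h4 ⊢
  rw [inv_mul_lt_iff₀ hm0, inv_mul_lt_iff₀ hm0]
  exact ⟨h3.trans_le (mul_le_mul_of_nonneg_right (le_max_left _ _) (h.nonneg i ω)),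
    h4.trans_le (mul_le_mul_of_nonneg_right (le_max_right _ _) (h.nonneg j ω))⟩

/-- Tail asymptotics of a weighted maximum. -/
lemma tendsto_max (h : IsUAIRegVarying P X α) (s : Finset ℕ) (hs : ∀ i ∈ s, 1 ≤ i)
    {θ : ℕ → ℝ} (hθ : ∀ i, 0 < θ i) :
    Tendsto (fun x => P.real (⋃ i ∈ s, {ω | x < θ i * X i ω}) / P.real {ω | x < X 1 ω}) atTop
      (nhds (∑ i ∈ s, θ i ^ α)) :=
  tendsto_measureReal_biUnion_div P (fun _ => measureReal_nonneg) (fun i x => {ω | x < θ i * X i ω})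
    (fun i x => h.measurableSet_lt_mul _ i x) (fun i => θ i ^ α) s
    (fun i hi => h.tendsto_lt_mul (hs i hi) (hθ i))
    (fun i hi j hj hij => h.tendsto_inter_lt_mul (hs i hi) (hs j hj) hij (hθ i))

/-- Tail asymptotics of a weighted sum. -/
lemma tendsto_sum (h : IsUAIRegVarying P X α) (s : Finset ℕ) (hs : ∀ i ∈ s, 1 ≤ i)
    {θ : ℕ → ℝ} (hθ : ∀ i, 0 < θ i) :
    Tendsto (fun x => P.real {ω | x < ∑ i ∈ s, θ i * X i ω} / P.real {ω | x < X 1 ω}) atTop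
      (nhds (∑ i ∈ s, θ i ^ α)) := by
  rcases s.eq_empty_or_nonempty with rfl | hne
  · refine tendsto_const_nhds.congr' ?_
    filter_upwards [eventually_gt_atTop 0] with x hx
    simp [hx.not_gt]
  have hn : (0 : ℝ) < s.card := by exact_mod_cast hne.card_pos
  have hpair : ∀ δ : ℝ, 0 < δ → Tendsto (fun x => ∑ q ∈ s.offDiag,
      P.real ({ω | x < (s.card / δ * θ q.1) * X q.1 ω} ∩ {ω | x < (s.card / δ * θ q.2) * X q.2 ω}) /
        P.real {ω | x < X 1 ω}) atTop (nhds 0) := by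
    intro δ hδ
    rw [← Finset.sum_const_zero (s := s.offDiag)]
    refine tendsto_finsetSum _ fun q hq => ?_
    rw [Finset.mem_offDiag] at hq
    exact h.tendsto_inter_lt_mul (hs _ hq.1) (hs _ hq.2.1) hq.2.2
      (mul_pos (div_pos hn hδ) (hθ _))
  have hupper : ∀ δ : ℝ, 0 < δ → δ < 1 → ∀ x, 0 < x →
      P.real {ω | x < ∑ i ∈ s, θ i * X i ω} / P.real {ω | x < X 1 ω} ≤
        P.real (⋃ i ∈ s, {ω | x < ((1 - δ)⁻¹ * θ i) * X i ω}) / P.real {ω | x < X 1 ω} +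
        ∑ q ∈ s.offDiag, P.real ({ω | x < (s.card / δ * θ q.1) * X q.1 ω} ∩
          {ω | x < (s.card / δ * θ q.2) * X q.2 ω}) / P.real {ω | x < X 1 ω} := by
    intro δ hδ0 hδ1 x hx
    have h1δ : 0 < 1 - δ := by linarith
    rw [← Finset.sum_div, ← add_div]
    refine div_le_div_of_nonneg_right ?_ measureReal_nonneg
    refine le_trans (measureReal_mono (s₂ := (⋃ i ∈ s, {ω | x < ((1 - δ)⁻¹ * θ i) * X i ω}) ∪
      ⋃ q ∈ s.offDiag, ({ω | x < (s.card / δ * θ q.1) * X q.1 ω} ∩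
          {ω | x < (s.card / δ * θ q.2) * X q.2 ω})) ?_ (measure_ne_top _ _)) ?_
    · intro ω hω
      rcases exists_large_of_lt_sum s (fun i => θ i * X i ω) hx hδ0.le hδ1.le hω with
        ⟨j, hj, hlt⟩ | ⟨i, hi, j, hj, hij, hlt, hlt'⟩
      · refine Or.inl (Set.mem_iUnion₂.2 ⟨j, hj, ?_⟩)
        simp only [Set.mem_ofPred_eq]
        rwa [mul_assoc, lt_inv_mul_iff₀ h1δ]
      · refine Or.inr (Set.mem_iUnion₂.2 ⟨(i, j), Finset.mem_offDiag.2 ⟨hi, hj, hij⟩, ?_⟩)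
        have hδn : 0 < δ / s.card := div_pos hδ0 hn
        simp only [Set.mem_inter_iff, Set.mem_ofPred_eq]
        rw [← inv_div, mul_assoc, mul_assoc, lt_inv_mul_iff₀ hδn, lt_inv_mul_iff₀ hδn]
        exact ⟨hlt, hlt'⟩
    · exact (measureReal_union_le _ _).trans
        (add_le_add le_rfl (measureReal_biUnion_finset_le _ _))
  have hlim : Tendsto (fun δ : ℝ => ∑ i ∈ s, ((1 - δ)⁻¹ * θ i) ^ α) (nhdsWithin 0 (Set.Ioi 0))
      (nhds (∑ i ∈ s, θ i ^ α)) := by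
    have : ContinuousAt (fun δ : ℝ => ∑ i ∈ s, ((1 - δ)⁻¹ * θ i) ^ α) 0 := by
      refine tendsto_finsetSum _ fun i _ => ?_
      refine ContinuousAt.rpow_const ?_ (Or.inr h.index_pos.le)
      refine ContinuousAt.mul ?_ continuousAt_const
      exact ContinuousAt.inv₀ (by fun_prop) (by simp)
    have := this.tendsto
    simp only [sub_zero, inv_one, one_mul] at this
    exact this.mono_left nhdsWithin_le_nhds
  rw [tendsto_order]
  refine ⟨fun a ha => ?_, fun b hb => ?_⟩
  · filter_upwards [(h.tendsto_max s hs hθ).eventually_const_lt ha] with x hx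
    refine hx.trans_le (div_le_div_of_nonneg_right (measureReal_mono ?_) measureReal_nonneg)
    intro ω hω
    obtain ⟨i, hi, hlt⟩ := Set.mem_iUnion₂.1 hω
    refine lt_of_lt_of_le (b := θ i * X i ω) hlt ?_
    exact Finset.single_le_sum (f := fun i => θ i * X i ω)
      (fun j _ => mul_nonneg (hθ j).le (h.nonneg j ω)) hi
  · obtain ⟨δ, hδb, hδ0, hδ1⟩ := ((hlim.eventually_lt_const hb).and
      (Ioo_mem_nhdsGT (zero_lt_one (α := ℝ)))).exists
    have h1δ : 0 < (1 - δ)⁻¹ := inv_pos.2 (by linarith)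
    have := ((h.tendsto_max s hs (θ := fun i => (1 - δ)⁻¹ * θ i)
      (fun i => mul_pos h1δ (hθ i))).add (hpair δ hδ0))
    rw [add_zero] at this
    filter_upwards [this.eventually_lt_const hδb, eventually_gt_atTop 0] with x hx hx0
    exact (hupper δ hδ0 hδ1 x hx0).trans_lt hx

/-- A bound on the tail of weighted sums, uniform in the weights `θ i ≥ 1`. -/
lemma exists_sum_bound (h : IsUAIRegVarying P X α) {p : ℝ} (hp : α < p) :
    ∃ C : ℝ, 0 < C ∧ ∃ x₀ : ℝ, 0 < x₀ ∧ ∀ x ≥ x₀, ∀ s : Finset ℕ, (∀ i ∈ s, 1 ≤ i) →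
      ∀ θ : ℕ → ℝ, (∀ i, 1 ≤ θ i) →
        P.real {ω | x < ∑ i ∈ s, θ i * X i ω} / P.real {ω | x < X 1 ω} ≤
          C * (s.card ^ p * ∑ i ∈ s, θ i ^ p) := by
  obtain ⟨C, hC, x₀, hx₀, hpot⟩ := exists_potter_bound (F := fun x => P.real {ω | x < X 1 ω})
    h.tail_pos (fun _ => measureReal_le_one)
    (fun x y hxy => measureReal_mono fun ω (hω : y < X 1 ω) => hxy.trans_lt hω) h.index_pos hp
    (h.regVarying 2 two_pos)
  refine ⟨C, hC, x₀, hx₀, fun x hx s hs θ hθ => ?_⟩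
  have hx0 : 0 < x := hx₀.trans_le hx
  have hF := h.tail_pos x hx0
  rcases s.eq_empty_or_nonempty with rfl | hne
  · simp [hx0.not_gt]
  have hn : (0 : ℝ) < s.card := by exact_mod_cast hne.card_pos
  have hn1 : (1 : ℝ) ≤ s.card := by exact_mod_cast hne.card_pos
  rw [div_le_iff₀ hF]
  calc P.real {ω | x < ∑ i ∈ s, θ i * X i ω}
      ≤ P.real (⋃ i ∈ s, {ω | x / s.card < θ i * X i ω}) := by
        refine measureReal_mono (fun ω (hω : x < _) => ?_) (measure_ne_top _ _)
        obtain ⟨i, hi, hlt⟩ : ∃ i ∈ s, x / s.card < θ i * X i ω := by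
          refine Finset.exists_lt_of_sum_lt (f := fun _ => x / s.card) ?_
          rw [Finset.sum_const, nsmul_eq_mul, mul_div_cancel₀ _ hn.ne']
          exact hω
        exact Set.mem_iUnion₂.2 ⟨i, hi, hlt⟩
    _ ≤ ∑ i ∈ s, P.real {ω | x / s.card < θ i * X i ω} := measureReal_biUnion_finset_le _ _
    _ ≤ ∑ i ∈ s, C * (s.card * θ i) ^ p * P.real {ω | x < X 1 ω} := by
        refine Finset.sum_le_sum fun i hi => ?_
        rw [h.measureReal_lt_mul (hs i hi) (one_pos.trans_le (hθ i)), div_div]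
        exact hpot x hx _ (one_le_mul_of_one_le_of_one_le hn1 (hθ i))
    _ = C * (s.card ^ p * ∑ i ∈ s, θ i ^ p) * P.real {ω | x < X 1 ω} := by
        rw [← Finset.sum_mul, Finset.mul_sum, Finset.mul_sum]
        congr 1
        refine Finset.sum_congr rfl fun i _ => ?_
        rw [Real.mul_rpow hn.le (zero_le_one.trans (hθ i))]

end IsUAIRegVarying

lemma lintegral_indepFun_prod {Ω β γ : Type*} [MeasurableSpace Ω] [MeasurableSpace β]
    [MeasurableSpace γ] {P : Measure Ω} [IsProbabilityMeasure P] {U : Ω → β} {Z : Ω → γ}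
    (hUZ : IndepFun U Z P) (hU : Measurable U) (hZ : Measurable Z) {f : β × γ → ENNReal}
    (hf : Measurable f) :
    ∫⁻ ω, f (U ω, Z ω) ∂P = ∫⁻ ω, ∫⁻ ω', f (U ω', Z ω) ∂P ∂P := by
  have := Measure.isProbabilityMeasure_map hU.aemeasurable (μ := P)
  have := Measure.isProbabilityMeasure_map hZ.aemeasurable (μ := P)
  rw [← lintegral_map hf (hU.prodMk hZ),
    (indepFun_iff_map_prod_eq_prod_map_map hU.aemeasurable hZ.aemeasurable).1 hUZ,
    lintegral_prod_symm' _ hf, lintegral_map hf.lintegral_prod_left' hZ]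
  refine lintegral_congr fun ω => ?_
  exact lintegral_map (hf.comp (measurable_id.prodMk measurable_const)) hU

lemma measurable_apply_nat {S β : Type*} [MeasurableSpace S] [MeasurableSpace β] {f : ℕ → S → β}
    (hf : ∀ n, Measurable (f n)) {N : S → ℕ} (hN : Measurable N) :
    Measurable fun s => f (N s) s :=
  (measurable_from_prod_countable_right (f := fun q : ℕ × S => f q.1 q.2) hf).comp
    (hN.prodMk measurable_id)

/-- Dominated convergence for the probability of events depending on two independent random
elements, after conditioning on the second one. -/
lemma tendsto_measureReal_div_of_indepFun {Ω β γ : Type*} [MeasurableSpace Ω] [MeasurableSpace β]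
    [MeasurableSpace γ] {P : Measure Ω} [IsProbabilityMeasure P] {U : Ω → β} {Z : Ω → γ}
    (hUZ : IndepFun U Z P) (hU : Measurable U) (hZ : Measurable Z) {A : ℝ → Set (β × γ)}
    (hA : ∀ x, MeasurableSet (A x)) {F : ℝ → ℝ} {L b : Ω → ℝ} (hF : ∀ x, 0 ≤ F x)
    (hlim : ∀ ω, Tendsto (fun x => P.real {ω' | (U ω', Z ω) ∈ A x} / F x) atTop (nhds (L ω)))
    {x₀ : ℝ} (hb : ∀ x ≥ x₀, ∀ ω, P.real {ω' | (U ω', Z ω) ∈ A x} / F x ≤ b ω)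
    (hbint : Integrable b P) :
    Tendsto (fun x => P.real {ω | (U ω, Z ω) ∈ A x} / F x) atTop (nhds (∫ ω, L ω ∂P)) := by
  have hsec : ∀ x, Measurable fun ω => P {ω' | (U ω', Z ω) ∈ A x} := by
    intro x
    have hmeas : Measurable fun z => (P.map U) ((fun u => (u, z)) ⁻¹' A x) := by
      have := Measure.isProbabilityMeasure_map hU.aemeasurable (μ := P)
      exact measurable_measure_prodMk_right (hA x)
    convert hmeas.comp hZ using 2 with ω
    simp only [Function.comp_apply]
    exact (Measure.map_apply hU (measurable_id.prodMk measurable_const (hA x))).symm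
  have heq : ∀ x, P.real {ω | (U ω, Z ω) ∈ A x} / F x =
      ∫ ω, P.real {ω' | (U ω', Z ω) ∈ A x} / F x ∂P := by
    intro x
    rw [integral_div]
    congr 1
    have h1 := lintegral_indepFun_prod hUZ hU hZ (f := (A x).indicator 1)
      (measurable_one.indicator (hA x))
    have h2 : ∀ W : Ω → β × γ, Measurable W →
        ∫⁻ ω, (A x).indicator (1 : β × γ → ENNReal) (W ω) ∂P = P {ω | W ω ∈ A x} := by
      intro W hW
      rw [← lintegral_map (measurable_one.indicator (hA x)) hW,
        lintegral_indicator_one (hA x), Measure.map_apply hW (hA x)]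
      rfl
    rw [h2 _ (hU.prodMk hZ)] at h1
    simp_rw [h2 _ (hU.prodMk measurable_const)] at h1
    simp only [Measure.real]
    rw [integral_toReal (hsec x).aemeasurable (Eventually.of_forall fun _ => measure_lt_top _ _),
      h1]
  simp_rw [heq]
  refine tendsto_integral_filter_of_dominated_convergence b ?_ ?_ hbint
    (Eventually.of_forall hlim)
  · exact Eventually.of_forall fun x =>
      ((hsec x).ennreal_toReal.div_const (F x)).aestronglyMeasurable
  · filter_upwards [eventually_ge_atTop x₀] with x hx
    refine Eventually.of_forall fun ω => ?_
    rw [Real.norm_of_nonneg (div_nonneg measureReal_nonneg (hF x))]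
    exact hb x hx ω

lemma lintegral_sum_orderStat {Ω : Type*} [MeasurableSpace Ω] {P : Measure Ω}
    [IsProbabilityMeasure P] {T : ℝ} {N : Ω → ℕ} (hNmeas : Measurable N)
    {V : ℕ → Ω → ℝ} (hVmeas : ∀ i, Measurable (V i))
    (hVid : ∀ i, IdentDistrib (V i) (V 0) P P)
    (hVlaw : ∀ B : Set ℝ, MeasurableSet B →
      P {ω | V 0 ω ∈ B} = ∫⁻ _ in B ∩ Set.Icc 0 T, ENNReal.ofReal (1 / T) ∂volume)
    {Ta : ℕ → Ω → ℝ} (hTameas : ∀ i, Measurable (Ta i)) {n : ℕ}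
    (hOS : ∀ B : Set (Fin n → ℝ), MeasurableSet B →
      P {ω | (fun i : Fin n => Ta ((i : ℕ) + 1) ω) ∈ B ∧ N ω = n} =
        P {ω | (fun i : Fin n =>
            V (((Tuple.sort (fun k : Fin n => V ((k : ℕ) + 1) ω)) i : ℕ) + 1) ω) ∈ B}
          * P {ω | N ω = n})
    {h : ℝ → ENNReal} (hh : Measurable h) :
    ∫⁻ ω in {ω | N ω = n}, ∑ j ∈ Finset.Icc 1 n, h (Ta j ω) ∂P =
      P {ω | N ω = n} * (n * (ENNReal.ofReal (1 / T) * ∫⁻ t in Set.Icc 0 T, h t)) := by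
  have hNn : MeasurableSet {ω | N ω = n} := hNmeas (measurableSet_singleton n)
  have hreindex : ∀ f : ℕ → ENNReal, ∑ j ∈ Finset.Icc 1 n, f j = ∑ i : Fin n, f (i + 1) := by
    intro f
    rw [Fin.sum_univ_eq_sum_range (fun i => f (i + 1)), Finset.range_eq_Ico,
      Finset.sum_Ico_add' f 0 n 1]
    rfl
  let S : (Fin n → ℝ) → ENNReal := fun v => ∑ i, h (v i)
  have hS : Measurable S := Finset.measurable_fun_sum _ fun i _ => hh.comp (measurable_pi_apply i)
  have hTav : Measurable fun ω => fun i : Fin n => Ta ((i : ℕ) + 1) ω :=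
    measurable_pi_lambda _ fun i => hTameas _
  have hVv : Measurable fun ω => fun i : Fin n => V ((i : ℕ) + 1) ω :=
    measurable_pi_lambda _ fun i => hVmeas _
  have hSTa : Measurable fun ω => S fun i : Fin n => Ta ((i : ℕ) + 1) ω := hS.comp hTav
  have hSV : Measurable fun ω => S fun i : Fin n => V ((i : ℕ) + 1) ω := hS.comp hVv
  have hlaw : (P.restrict {ω | N ω = n}).map (fun ω => S fun i : Fin n => Ta ((i : ℕ) + 1) ω) =
      P {ω | N ω = n} • P.map (fun ω => S fun i : Fin n => V ((i : ℕ) + 1) ω) := by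
    ext C hC
    rw [Measure.map_apply hSTa hC, Measure.restrict_apply (hSTa hC),
      Measure.smul_apply, Measure.map_apply hSV hC, smul_eq_mul, mul_comm]
    refine (hOS (S ⁻¹' C) (hS hC)).trans ?_
    congr 2
    ext ω
    have : (S fun i : Fin n =>
        V (((Tuple.sort (fun k : Fin n => V ((k : ℕ) + 1) ω)) i : ℕ) + 1) ω) =
        S fun i : Fin n => V ((i : ℕ) + 1) ω :=
      Equiv.sum_comp (Tuple.sort (fun k : Fin n => V ((k : ℕ) + 1) ω))
        (fun i : Fin n => h (V ((i : ℕ) + 1) ω))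
    change S _ ∈ C ↔ S _ ∈ C
    rw [this]
  have hV0 : P.map (V 0) = ENNReal.ofReal (1 / T) • volume.restrict (Set.Icc 0 T) := by
    ext B hB
    rw [Measure.map_apply (hVmeas 0) hB, Measure.smul_apply, Measure.restrict_apply hB]
    refine (hVlaw B hB).trans ?_
    rw [setLIntegral_const, smul_eq_mul]
  have hVi : ∀ i, ∫⁻ ω, h (V i ω) ∂P = ENNReal.ofReal (1 / T) * ∫⁻ t in Set.Icc 0 T, h t := by
    intro i
    rw [← lintegral_map hh (hVmeas i), (hVid i).map_eq, hV0, lintegral_smul_measure, smul_eq_mul]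
  simp_rw [hreindex]
  calc ∫⁻ ω in {ω | N ω = n}, S (fun i : Fin n => Ta ((i : ℕ) + 1) ω) ∂P
      = ∫⁻ y, y ∂((P.restrict {ω | N ω = n}).map
          (fun ω => S fun i : Fin n => Ta ((i : ℕ) + 1) ω)) :=
        (lintegral_map measurable_id hSTa).symm
    _ = P {ω | N ω = n} * ∫⁻ ω, S (fun i : Fin n => V ((i : ℕ) + 1) ω) ∂P := by
        rw [hlaw, lintegral_smul_measure, smul_eq_mul,
          lintegral_map (f := fun y => y) measurable_id hSV]
    _ = _ := by
        congr 1
        refine (lintegral_finsetSum _ fun (i : Fin n) _ => hh.comp (hVmeas (i + 1))).trans ?_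
        simp only [Function.comp_apply, hVi]
        simp

/-- Campbell-type formula for marked arrival times, weighted by a function of their number. -/
lemma lintegral_sum_marked {Ω γ : Type*} [MeasurableSpace Ω] [MeasurableSpace γ] {P : Measure Ω}
    [IsProbabilityMeasure P] {T : ℝ} {N : Ω → ℕ} (hNmeas : Measurable N)
    {V : ℕ → Ω → ℝ} (hVmeas : ∀ i, Measurable (V i))
    (hVid : ∀ i, IdentDistrib (V i) (V 0) P P)
    (hVlaw : ∀ B : Set ℝ, MeasurableSet B →
      P {ω | V 0 ω ∈ B} = ∫⁻ _ in B ∩ Set.Icc 0 T, ENNReal.ofReal (1 / T) ∂volume)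
    {Ta : ℕ → Ω → ℝ} (hTameas : ∀ i, Measurable (Ta i))
    (hOS : ∀ n : ℕ, ∀ B : Set (Fin n → ℝ), MeasurableSet B →
      P {ω | (fun i : Fin n => Ta ((i : ℕ) + 1) ω) ∈ B ∧ N ω = n} =
        P {ω | (fun i : Fin n =>
            V (((Tuple.sort (fun k : Fin n => V ((k : ℕ) + 1) ω)) i : ℕ) + 1) ω) ∈ B}
          * P {ω | N ω = n})
    {w : ℕ → Ω → ℝ} (hwmeas : ∀ i, Measurable (w i))
    (hwid : ∀ i, 1 ≤ i → IdentDistrib (w i) (w 1) P P)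
    {X : Ω → γ} (hX : Measurable X)
    (hw_indep : IndepFun (fun ω => fun i : ℕ => w i ω)
      (fun ω => (N ω, fun i : ℕ => Ta i ω, X ω)) P)
    {g : ℝ → ℝ → ENNReal} (hg : Measurable (Function.uncurry g)) (c : ℕ → ENNReal) :
    ∫⁻ ω, c (N ω) * ∑ j ∈ Finset.Icc 1 (N ω), g (w j ω) (Ta j ω) ∂P =
      (∑' n : ℕ, P {ω | N ω = n} * (c n * n)) *
        (ENNReal.ofReal (1 / T) * ∫⁻ ω, (∫⁻ t in Set.Icc 0 T, g (w 1 ω) t) ∂P) := by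
  set h : ℝ → ENNReal := fun t => ∫⁻ ω, g (w 1 ω) t ∂P with hh_def
  have hgw : Measurable fun q : Ω × ℝ => g (w 1 q.1) q.2 :=
    hg.comp (((hwmeas 1).comp measurable_fst).prodMk measurable_snd)
  have hh : Measurable h := hgw.lintegral_prod_left'
  have hstep : ∫⁻ ω, c (N ω) * ∑ j ∈ Finset.Icc 1 (N ω), g (w j ω) (Ta j ω) ∂P =
      ∫⁻ ω, c (N ω) * ∑ j ∈ Finset.Icc 1 (N ω), h (Ta j ω) ∂P := by
    have hwm : Measurable fun ω => fun i : ℕ => w i ω := measurable_pi_lambda _ hwmeas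
    have hZm : Measurable fun ω => (N ω, fun i : ℕ => Ta i ω, X ω) :=
      hNmeas.prodMk ((measurable_pi_lambda _ hTameas).prodMk hX)
    have hgj : ∀ j, Measurable fun q : (ℕ → ℝ) × ℕ × (ℕ → ℝ) × γ => g (q.1 j) (q.2.2.1 j) := by
      intro j
      have : Measurable fun q : (ℕ → ℝ) × ℕ × (ℕ → ℝ) × γ => (q.1 j, q.2.2.1 j) := by fun_prop
      exact hg.comp this
    have := lintegral_indepFun_prod hw_indep hwm hZm
      (f := fun q => c q.2.1 * ∑ j ∈ Finset.Icc 1 q.2.1, g (q.1 j) (q.2.2.1 j))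
      (measurable_apply_nat (f := fun n (q : (ℕ → ℝ) × ℕ × (ℕ → ℝ) × γ) =>
        c n * ∑ j ∈ Finset.Icc 1 n, g (q.1 j) (q.2.2.1 j))
        (fun n => (Finset.measurable_fun_sum _ fun j _ => hgj j).const_mul _)
        (measurable_fst.comp measurable_snd))
    rw [this]
    refine lintegral_congr fun ω => ?_
    have hgt : ∀ j t, Measurable fun ω' => g (w j ω') t := fun j t =>
      hg.comp ((hwmeas j).prodMk measurable_const)
    simp only
    rw [lintegral_const_mul _ (Finset.measurable_fun_sum _ fun j _ => hgt j _),
      lintegral_finsetSum _ fun j _ => hgt j _]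
    congr 1
    refine Finset.sum_congr rfl fun j hj => ?_
    have hgt' : Measurable fun v => g v (Ta j ω) :=
      hg.comp (measurable_id.prodMk measurable_const)
    have hmap := (hwid j (Finset.mem_Icc.1 hj).1).map_eq
    rw [hh_def]
    simp only
    rw [← lintegral_map hgt' (hwmeas j), hmap, lintegral_map hgt' (hwmeas 1)]
  have hdecomp : ∀ f : Ω → ENNReal, ∫⁻ ω, f ω ∂P = ∑' n : ℕ, ∫⁻ ω in {ω | N ω = n}, f ω ∂P := by
    intro f
    rw [← lintegral_iUnion (s := fun n => {ω | N ω = n})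
      (fun n => hNmeas (measurableSet_singleton n))
      (fun m n hmn => Set.disjoint_left.2 fun ω (h1 : N ω = m) (h2 : N ω = n) => hmn (h1 ▸ h2))]
    have : (⋃ n, {ω | N ω = n}) = Set.univ := Set.eq_univ_of_forall fun ω =>
      Set.mem_iUnion.2 ⟨N ω, rfl⟩
    rw [this, Measure.restrict_univ]
  have hswap : ∫⁻ ω, (∫⁻ t in Set.Icc 0 T, g (w 1 ω) t) ∂P = ∫⁻ t in Set.Icc 0 T, h t :=
    lintegral_lintegral_swap hgw.aemeasurable
  rw [hstep, hdecomp, hswap, ← ENNReal.tsum_mul_right]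
  refine tsum_congr fun n => ?_
  have hc : ∫⁻ ω in {ω | N ω = n}, c (N ω) * ∑ j ∈ Finset.Icc 1 (N ω), h (Ta j ω) ∂P =
      ∫⁻ ω in {ω | N ω = n}, c n * ∑ j ∈ Finset.Icc 1 n, h (Ta j ω) ∂P := by
    refine setLIntegral_congr_fun (hNmeas (measurableSet_singleton n)) fun ω hω => ?_
    have : N ω = n := hω
    simp only [this]
  have hhT : ∀ j, Measurable fun ω => h (Ta j ω) := fun j => hh.comp (hTameas j)
  rw [hc, lintegral_const_mul _ (Finset.measurable_fun_sum _ fun j _ => hhT j),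
    lintegral_sum_orderStat hNmeas hVmeas hVid hVlaw hTameas (hOS n) hh]
  ring

lemma ae_arrivals_monotone {Ω : Type*} [MeasurableSpace Ω] {P : Measure Ω}
    {T : ℝ} {N : Ω → ℕ}
    {V : ℕ → Ω → ℝ} (hVid : ∀ i, IdentDistrib (V i) (V 0) P P)
    (hVlaw : ∀ B : Set ℝ, MeasurableSet B →
      P {ω | V 0 ω ∈ B} = ∫⁻ _ in B ∩ Set.Icc 0 T, ENNReal.ofReal (1 / T) ∂volume)
    {Ta : ℕ → Ω → ℝ}
    (hOS : ∀ n : ℕ, ∀ B : Set (Fin n → ℝ), MeasurableSet B →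
      P {ω | (fun i : Fin n => Ta ((i : ℕ) + 1) ω) ∈ B ∧ N ω = n} =
        P {ω | (fun i : Fin n =>
            V (((Tuple.sort (fun k : Fin n => V ((k : ℕ) + 1) ω)) i : ℕ) + 1) ω) ∈ B}
          * P {ω | N ω = n}) :
    ∀ᵐ ω ∂P, ∀ j k : ℕ, 1 ≤ j → j ≤ k → k ≤ N ω → Ta j ω ≤ Ta k ω ∧ Ta k ω ≤ T := by
  have hV : ∀ᵐ ω ∂P, ∀ i, V i ω ≤ T := by
    rw [ae_all_iff]
    intro i
    have h0 : P {ω | V 0 ω ∈ Set.Ioi T} = 0 := by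
      rw [hVlaw _ measurableSet_Ioi]
      have : Set.Ioi T ∩ Set.Icc 0 T = ∅ := by
        ext t; simp only [Set.mem_inter_iff, Set.mem_Ioi, Set.mem_Icc, Set.mem_empty_iff_false]
        constructor
        · rintro ⟨h1, _, h2⟩; exact h2.not_gt h1
        · exact False.elim
      rw [this]; simp
    have h1 : P {ω | V i ω ∈ Set.Ioi T} = 0 :=
      ((hVid i).measure_mem_eq measurableSet_Ioi).trans h0
    rw [ae_iff]
    convert h1 using 2
    ext ω
    simp
  have hN : ∀ᵐ ω ∂P, ∀ n, N ω = n →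
      Monotone (fun i : Fin n => Ta ((i : ℕ) + 1) ω) ∧ ∀ i : Fin n, Ta ((i : ℕ) + 1) ω ≤ T := by
    rw [ae_all_iff]
    intro n
    have hB : MeasurableSet {v : Fin n → ℝ | Monotone v ∧ ∀ i, v i ≤ T} := by
      refine (IsClosed.inter (s₁ := {v : Fin n → ℝ | Monotone v}) isClosed_monotone
        (s₂ := {v : Fin n → ℝ | ∀ i, v i ≤ T}) ?_).measurableSet
      have : {v : Fin n → ℝ | ∀ i, v i ≤ T} = ⋂ i, {v : Fin n → ℝ | v i ≤ T} := by
        ext v; simp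
      rw [this]
      exact isClosed_iInter fun i => isClosed_le (continuous_apply i) continuous_const
    have hz := hOS n _ hB.compl
    have hz' : P {ω | (fun i : Fin n =>
        V (((Tuple.sort (fun k : Fin n => V ((k : ℕ) + 1) ω)) i : ℕ) + 1) ω) ∈
          {v : Fin n → ℝ | Monotone v ∧ ∀ i, v i ≤ T}ᶜ} = 0 := by
      refine measure_mono_null (t := {ω | ¬ ∀ i, V i ω ≤ T}) ?_ (ae_iff.1 hV)
      intro ω hω hall
      exact hω ⟨Tuple.monotone_sort (fun k : Fin n => V ((k : ℕ) + 1) ω), fun i => hall _⟩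
    rw [hz', zero_mul] at hz
    rw [ae_iff]
    refine measure_mono_null ?_ hz
    intro ω hω
    have hω' : ¬ (N ω = n → Monotone (fun i : Fin n => Ta ((i : ℕ) + 1) ω) ∧
      ∀ i : Fin n, Ta ((i : ℕ) + 1) ω ≤ T) := hω
    rw [Classical.not_imp] at hω'
    exact ⟨hω'.2, hω'.1⟩
  filter_upwards [hN] with ω hω j k hj hjk hk
  obtain ⟨hmono, hle⟩ := hω (N ω) rfl
  obtain ⟨j, rfl⟩ := Nat.exists_eq_add_of_le' hj
  obtain ⟨k, rfl⟩ := Nat.exists_eq_add_of_le' (hj.trans hjk)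
  exact ⟨hmono (a := ⟨j, by omega⟩) (b := ⟨k, by omega⟩) (by simpa using hjk), hle ⟨k, by omega⟩⟩

lemma tsum_poisson_mul_self {r : ℝ} (hr : 0 ≤ r) :
    ∑' n : ℕ, ENNReal.ofReal (Real.exp (-r) * r ^ n / n.factorial) * n = ENNReal.ofReal r := by
  have hone : ∑' n : ℕ, ENNReal.ofReal (Real.exp (-r) * r ^ n / n.factorial) = 1 := by
    have h := hasSum_one_poissonMeasure ⟨r, hr⟩
    rw [← ENNReal.ofReal_one]
    refine Eq.trans (ENNReal.ofReal_tsum_of_nonneg (fun n => by positivity) h.summable).symm ?_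
    exact congrArg _ h.tsum_eq
  rw [tsum_eq_zero_add' ENNReal.summable]
  simp only [Nat.cast_zero, mul_zero, zero_add]
  have : ∀ n : ℕ, ENNReal.ofReal (Real.exp (-r) * r ^ (n + 1) / (n + 1).factorial) *
      ((n + 1 : ℕ) : ENNReal) =
      ENNReal.ofReal r * ENNReal.ofReal (Real.exp (-r) * r ^ n / n.factorial) := by
    intro n
    rw [← ENNReal.ofReal_natCast, ← ENNReal.ofReal_mul (by positivity), ← ENNReal.ofReal_mul hr]
    congr 1
    rw [Nat.factorial_succ]
    push_cast
    field_simp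
    ring
  simp_rw [this]
  rw [ENNReal.tsum_mul_left, hone, mul_one]

lemma tsum_poisson_rpow_lt_top {r : ℝ} (hr : 0 ≤ r) (p : ℝ) :
    ∑' n : ℕ, ENNReal.ofReal (Real.exp (-r) * r ^ n / n.factorial) *
      (ENNReal.ofReal ((n : ℝ) ^ p) * n) < ⊤ := by
  set q : ℕ := ⌈p⌉₊ + 1 with hq
  have hs : Summable fun n : ℕ => (q.factorial * Real.exp (-r)) *
      ((r * Real.exp 1) ^ n / n.factorial) :=
    (Real.summable_pow_div_factorial _).mul_left _
  refine lt_of_le_of_lt (ENNReal.tsum_le_tsum fun n => ?_) hs.tsum_ofReal_lt_top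
  rw [← ENNReal.ofReal_natCast n, ← ENNReal.ofReal_mul (by positivity),
    ← ENNReal.ofReal_mul (by positivity)]
  refine ENNReal.ofReal_le_ofReal ?_
  have hn : (n : ℝ) ^ p * n ≤ q.factorial * Real.exp 1 ^ n := by
    rcases Nat.eq_zero_or_pos n with rfl | hn
    · simp
    have hn1 : (1 : ℝ) ≤ n := by exact_mod_cast hn
    have h1 : (n : ℝ) ^ p ≤ (n : ℝ) ^ ⌈p⌉₊ := by
      rw [← Real.rpow_natCast]
      exact Real.rpow_le_rpow_of_exponent_le hn1 (Nat.le_ceil p)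
    have h2 := Real.pow_div_factorial_le_exp (n : ℝ) (by positivity) q
    rw [div_le_iff₀ (by positivity)] at h2
    calc (n : ℝ) ^ p * n ≤ (n : ℝ) ^ ⌈p⌉₊ * n := by gcongr
      _ = (n : ℝ) ^ q := by rw [hq, pow_succ]
      _ ≤ Real.exp n * q.factorial := h2
      _ = q.factorial * Real.exp 1 ^ n := by rw [← Real.exp_nat_mul, mul_one, mul_comm]
  calc Real.exp (-r) * r ^ n / n.factorial * ((n : ℝ) ^ p * n)
      ≤ Real.exp (-r) * r ^ n / n.factorial * (q.factorial * Real.exp 1 ^ n) := by gcongr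
    _ = _ := by rw [mul_pow]; ring

/-- The integral over `[0, T]` of the maximal elimination factor raised to the power `a`. -/
lemma lintegral_max_exp_rpow {T : ℝ} (hT : 0 < T) {a : ℝ} (ha : 0 < a) (v : ℝ) :
    ∫⁻ t in Set.Icc 0 T, ENNReal.ofReal (max 1 (Real.exp (-(v * (T - t)))) ^ a) =
      ENNReal.ofReal (if v ≤ 0 then
        (if v = 0 then T else (1 - Real.exp (-(a * v * T))) / (a * v)) else T) := by
  have hone : ∀ g : ℝ → ℝ, (∀ t ∈ Set.Icc 0 T, g t = 1) →
      ∫⁻ t in Set.Icc 0 T, ENNReal.ofReal (g t) = ENNReal.ofReal T := by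
    intro g hg
    rw [setLIntegral_congr_fun (g := fun _ => 1) measurableSet_Icc fun t ht => by
      simp only [hg t ht, ENNReal.ofReal_one]]
    simp
  rcases lt_trichotomy v 0 with hv | rfl | hv
  · rw [if_pos hv.le, if_neg hv.ne]
    have hcongr : ∫⁻ t in Set.Icc 0 T, ENNReal.ofReal (max 1 (Real.exp (-(v * (T - t)))) ^ a) =
        ∫⁻ t in Set.Icc 0 T, ENNReal.ofReal (Real.exp (-(a * v * (T - t)))) := by
      refine setLIntegral_congr_fun measurableSet_Icc fun t ht => ?_
      have h1 : (1 : ℝ) ≤ Real.exp (-(v * (T - t))) :=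
        Real.one_le_exp (by nlinarith [ht.2])
      rw [max_eq_right h1, ← Real.exp_mul]
      ring_nf
    have hcont : Continuous fun t => Real.exp (-(a * v * (T - t))) := by fun_prop
    have hint : ∫ t in (0 : ℝ)..T, Real.exp (-(a * v * (T - t))) =
        (1 - Real.exp (-(a * v * T))) / (a * v) := by
      rw [intervalIntegral.integral_eq_sub_of_hasDerivAt
        (f := fun t => Real.exp (-(a * v * (T - t))) / (a * v)) (fun t _ => ?_)
        (hcont.intervalIntegrable _ _)]
      · simp [sub_div]
      · have h1 : HasDerivAt (fun t => -(a * v * (T - t))) (a * v) t := by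
          have := (((hasDerivAt_id t).const_sub T).const_mul (a * v)).fun_neg
          simpa using this
        have h2 := h1.exp.div_const (a * v)
        rwa [mul_div_cancel_right₀ _ (mul_ne_zero ha.ne' hv.ne)] at h2
    rw [hcongr, ← hint, intervalIntegral.integral_of_le hT.le, ← integral_Icc_eq_integral_Ioc,
      ofReal_integral_eq_lintegral_ofReal (hcont.continuousOn.integrableOn_Icc)
        (Eventually.of_forall fun t => (Real.exp_pos _).le)]
  · simp
  · rw [if_neg hv.not_ge]
    refine hone _ fun t ht => ?_
    rw [max_eq_left (Real.exp_le_one_iff.2 (by nlinarith [ht.2])), Real.one_rpow]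

lemma lintegral_max_exp_rpow_le {T p : ℝ} (hp : 0 < p) (v : ℝ) :
    ∫⁻ t in Set.Icc 0 T, ENNReal.ofReal (max 1 (Real.exp (-(v * (T - t)))) ^ p) ≤
      ENNReal.ofReal (Real.exp (p * max (-v) 0 * T)) * ENNReal.ofReal T := by
  calc ∫⁻ t in Set.Icc 0 T, ENNReal.ofReal (max 1 (Real.exp (-(v * (T - t)))) ^ p)
      ≤ ∫⁻ _ in Set.Icc 0 T, ENNReal.ofReal (Real.exp (p * max (-v) 0 * T)) := by
        refine setLIntegral_mono measurable_const fun t ht => ENNReal.ofReal_le_ofReal ?_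
        have h0 : 0 ≤ max (-v) 0 := le_max_right _ _
        have hTt : 0 ≤ T - t := by linarith [ht.2]
        have h1 : max 1 (Real.exp (-(v * (T - t)))) ≤ Real.exp (max (-v) 0 * T) := by
          refine max_le (Real.one_le_exp (by nlinarith [ht.1])) (Real.exp_le_exp.2 ?_)
          nlinarith [mul_le_mul_of_nonneg_right (le_max_left (-v) 0) hTt, ht.1]
        calc max 1 (Real.exp (-(v * (T - t)))) ^ p ≤ Real.exp (max (-v) 0 * T) ^ p := by
              gcongr
          _ = Real.exp (p * max (-v) 0 * T) := by
              rw [← Real.exp_mul]; ring_nf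
    _ = _ := by simp

lemma ite_elimination_nonneg {T a : ℝ} (hT : 0 < T) (ha : 0 < a) (v : ℝ) :
    0 ≤ if v ≤ 0 then (if v = 0 then T else (1 - Real.exp (-(a * v * T))) / (a * v)) else 0 := by
  split_ifs with h1 h2
  · exact hT.le
  · have hv : v < 0 := lt_of_le_of_ne h1 h2
    have hav : a * v < 0 := mul_neg_of_pos_of_neg ha hv
    refine div_nonneg_of_nonpos ?_ hav.le
    have := Real.one_le_exp (x := -(a * v * T)) (by nlinarith)
    linarith
  · exact le_rfl

lemma lt_shotNoise_of_lt_max_mul {n : ℕ} {T x : ℝ} {X w t : ℕ → ℝ} (hX : ∀ i, 0 ≤ X i)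
    {j : ℕ} (hj : j ∈ Finset.Icc 1 n)
    (hx : x < max 1 (Real.exp (-(w j * (T - t j)))) * X j) :
    x < max (⨆ k : Fin n, ∑ j ∈ Finset.Icc 1 ((k : ℕ) + 1),
          X j * Real.exp (-(w j * (t ((k : ℕ) + 1) - t j))))
        (∑ j ∈ Finset.Icc 1 n, X j * Real.exp (-(w j * (T - t j)))) := by
  refine hx.trans_le ?_
  rw [Finset.mem_Icc] at hj
  rcases max_choice 1 (Real.exp (-(w j * (T - t j)))) with h | h
  · rw [h, one_mul]
    refine le_max_of_le_left ?_
    refine le_trans ?_ (le_ciSup (Set.finite_range _).bddAbove (⟨j - 1, by omega⟩ : Fin n))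
    simp only [Nat.sub_add_cancel hj.1]
    refine le_trans ?_ (Finset.single_le_sum
      (f := fun i => X i * Real.exp (-(w i * (t j - t i)))) (s := Finset.Icc 1 j)
      (fun i _ => mul_nonneg (hX i) (Real.exp_pos _).le) (Finset.mem_Icc.2 ⟨hj.1, le_rfl⟩))
    simp
  · rw [h, mul_comm]
    exact le_max_of_le_right (Finset.single_le_sum
      (f := fun i => X i * Real.exp (-(w i * (T - t i))))
      (fun i _ => mul_nonneg (hX i) (Real.exp_pos _).le) (Finset.mem_Icc.2 hj))

lemma shotNoise_le_sum {n : ℕ} {T : ℝ} {X w t : ℕ → ℝ} (hX : ∀ i, 0 ≤ X i)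
    (ht : ∀ j k : ℕ, 1 ≤ j → j ≤ k → k ≤ n → t j ≤ t k ∧ t k ≤ T) :
    max (⨆ k : Fin n, ∑ j ∈ Finset.Icc 1 ((k : ℕ) + 1),
          X j * Real.exp (-(w j * (t ((k : ℕ) + 1) - t j))))
        (∑ j ∈ Finset.Icc 1 n, X j * Real.exp (-(w j * (T - t j)))) ≤
      ∑ j ∈ Finset.Icc 1 n, max 1 (Real.exp (-(w j * (T - t j)))) * X j := by
  have hnonneg : ∀ j, 0 ≤ max 1 (Real.exp (-(w j * (T - t j)))) * X j := fun j =>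
    mul_nonneg (zero_le_one.trans (le_max_left _ _)) (hX j)
  refine max_le (Real.iSup_le (fun k => ?_) (Finset.sum_nonneg fun j _ => hnonneg j)) ?_
  · have hk := k.2
    refine le_trans (Finset.sum_le_sum fun j hj => ?_) (Finset.sum_le_sum_of_subset_of_nonneg
      (Finset.Icc_subset_Icc le_rfl (by omega)) fun j _ _ => hnonneg j)
    rw [Finset.mem_Icc] at hj
    obtain ⟨h1, h2⟩ := ht j (k + 1) hj.1 hj.2 (by omega)
    rw [mul_comm]
    refine mul_le_mul_of_nonneg_right ?_ (hX j)
    rcases le_total 0 (w j) with hw | hw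
    · exact le_max_of_le_left (Real.exp_le_one_iff.2 (by nlinarith))
    · exact le_max_of_le_right (Real.exp_le_exp.2 (by nlinarith))
  · refine Finset.sum_le_sum fun j _ => ?_
    rw [mul_comm]
    exact mul_le_mul_of_nonneg_right (le_max_right _ _) (hX j)

/-- Finite-time ruin probability of the KDEM exponential shot noise with random
elimination parameter: in the setting of Statement 15, the ruin probability
`ψ(x,T) = P(max{max_{1 ≤ k ≤ N} ∑_{j=1}^k X j e^{−w j (Ta k − Ta j)},
∑_{j=1}^N X j e^{−w j (T − Ta j)}} > x)` satisfies
`ψ(x,T)/P(X 1 > x) → lam · (T · P(w > 0) + E[((1 − e^{−α w T})/(α w)) 1_{w ≤ 0}])`,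
with `(1 − e^{−α w T})/(α w)` interpreted as `T` at `w = 0`. -/
theorem kdem_ruin_probability
    {Ω : Type*} [MeasurableSpace Ω] (P : Measure Ω) [IsProbabilityMeasure P]
    (T : ℝ) (hT : 0 < T) (lam : ℝ) (hlam : 0 < lam)
    -- the shocks
    (X : ℕ → Ω → ℝ) (hXmeas : ∀ i, Measurable (X i))
    (hXnonneg : ∀ i ω, 0 ≤ X i ω)
    (hXid : ∀ i, 1 ≤ i → IdentDistrib (X i) (X 1) P P)
    (α : ℝ) (hα : 0 < α)
    (hRVpos : ∀ x : ℝ, 0 < x → 0 < P {ω | x < X 1 ω})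
    (hRV : ∀ t : ℝ, 0 < t →
      Tendsto (fun x => (P {ω | t * x < X 1 ω}).toReal / (P {ω | x < X 1 ω}).toReal)
        atTop (nhds (t ^ (-α))))
    (hUAI : ∀ ε : ℝ, 0 < ε → ∃ x₀ : ℝ, ∀ x ≥ x₀, ∀ i j : ℕ, 1 ≤ i → 1 ≤ j → i ≠ j →
      (P {ω | x < X i ω ∧ x < X j ω}).toReal ≤ ε * (P {ω | x < X 1 ω}).toReal)
    -- the Poisson number of shocks
    (N : Ω → ℕ) (hNmeas : Measurable N)
    (hNpois : ∀ k : ℕ,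
      P {ω | N ω = k} =
        ENNReal.ofReal (Real.exp (-(lam * T)) * (lam * T) ^ k / (Nat.factorial k)))
    -- i.i.d. uniform random variables on `[0, T]`
    (V : ℕ → Ω → ℝ) (hVmeas : ∀ i, Measurable (V i))
    (hViid : iIndepFun V P)
    (hVid : ∀ i, IdentDistrib (V i) (V 0) P P)
    (hVlaw : ∀ B : Set ℝ, MeasurableSet B →
      P {ω | V 0 ω ∈ B} = ∫⁻ t in B ∩ Set.Icc 0 T, ENNReal.ofReal (1 / T) ∂volume)
    -- the arrival times: conditionally on `N = n`, distributed as the order statistics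
    (Ta : ℕ → Ω → ℝ) (hTameas : ∀ i, Measurable (Ta i))
    (hOS : ∀ n : ℕ, ∀ B : Set (Fin n → ℝ), MeasurableSet B →
      P {ω | (fun i : Fin n => Ta ((i : ℕ) + 1) ω) ∈ B ∧ N ω = n} =
        P {ω | (fun i : Fin n =>
            V (((Tuple.sort (fun k : Fin n => V ((k : ℕ) + 1) ω)) i : ℕ) + 1) ω) ∈ B}
          * P {ω | N ω = n})
    -- the i.i.d. elimination parameters, satisfying the Cramér condition
    (w : ℕ → Ω → ℝ) (hwmeas : ∀ i, Measurable (w i))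
    (hwiid : iIndepFun w P)
    (hwid : ∀ i, 1 ≤ i → IdentDistrib (w i) (w 1) P P)
    (hwmom : ∃ p : ℝ, α < p ∧
      ∫⁻ ω, ENNReal.ofReal (Real.exp (p * max (-(w 1 ω)) 0 * T)) ∂P < ⊤)
    -- independence between the various ingredients
    (hw_indep : IndepFun (fun ω => fun i : ℕ => w i ω)
      (fun ω => (N ω, fun i : ℕ => Ta i ω, fun i : ℕ => X i ω)) P)
    (hX_indep : IndepFun (fun ω => fun i : ℕ => X i ω)
      (fun ω => (N ω, fun i : ℕ => Ta i ω, fun i : ℕ => w i ω, fun i : ℕ => V i ω)) P) :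
    Tendsto (fun x =>
        (P {ω | x < max
            (⨆ k : Fin (N ω), ∑ j ∈ Finset.Icc 1 ((k : ℕ) + 1),
              X j ω * Real.exp (-(w j ω * (Ta ((k : ℕ) + 1) ω - Ta j ω))))
            (∑ j ∈ Finset.Icc 1 (N ω),
              X j ω * Real.exp (-(w j ω * (T - Ta j ω))))}).toReal
          / (P {ω | x < X 1 ω}).toReal)
      atTop
      (nhds (lam * (T * (P {ω | 0 < w 1 ω}).toReal +
        ∫ ω, (if w 1 ω ≤ 0 then
            (if w 1 ω = 0 then T
              else (1 - Real.exp (-(α * w 1 ω * T))) / (α * w 1 ω))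
          else 0) ∂P))) := by
  obtain ⟨p, hp, hpmom⟩ := hwmom
  have hp0 : 0 < p := hα.trans hp
  have hRVX : IsUAIRegVarying P X α :=
    { measurable := hXmeas
      nonneg := hXnonneg
      identDistrib := hXid
      index_pos := hα
      tail_pos := fun x hx => ENNReal.toReal_pos (hRVpos x hx).ne' (measure_ne_top _ _)
      regVarying := hRV
      uai := hUAI }
  -- the shocks are independent of `Z`, on which the elimination factors depend
  set U : Ω → ℕ → ℝ := fun ω i => X i ω
  set Z : Ω → ℕ × (ℕ → ℝ) × (ℕ → ℝ) × (ℕ → ℝ) := fun ω =>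
    (N ω, fun i : ℕ => Ta i ω, fun i : ℕ => w i ω, fun i : ℕ => V i ω)
  have hU : Measurable U := measurable_pi_lambda _ hXmeas
  have hZ : Measurable Z := hNmeas.prodMk ((measurable_pi_lambda _ hTameas).prodMk
    ((measurable_pi_lambda _ hwmeas).prodMk (measurable_pi_lambda _ hVmeas)))
  let M : ℕ × (ℕ → ℝ) × (ℕ → ℝ) × (ℕ → ℝ) → ℕ → ℝ := fun z j =>
    max 1 (Real.exp (-(z.2.2.1 j * (T - z.2.1 j))))
  have hM : ∀ j, Measurable fun z => M z j := fun j => by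
    simp only [M]
    fun_prop
  have hM1 : ∀ z j, 1 ≤ M z j := fun z j => le_max_left _ _
  have hM0 : ∀ z j, 0 < M z j := fun z j => one_pos.trans_le (hM1 z j)
  have hMZ : ∀ j, Measurable fun ω => M (Z ω) j := fun j => (hM j).comp hZ
  have hcard : ∀ n : ℕ, (Finset.Icc 1 n).card = n := fun n => by simp
  have hone : ∀ n : ℕ, ∀ i ∈ Finset.Icc 1 n, 1 ≤ i := fun n i hi => (Finset.mem_Icc.1 hi).1
  -- moments of the elimination factors
  have hg : ∀ a : ℝ, Measurable (Function.uncurry fun v t : ℝ =>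
      ENNReal.ofReal (max 1 (Real.exp (-(v * (T - t)))) ^ a)) := fun a => by
    simp only [Function.uncurry_def]
    fun_prop
  have hmoment : ∀ (a : ℝ) (c : ℕ → ENNReal),
      ∫⁻ ω, c (N ω) * ∑ j ∈ Finset.Icc 1 (N ω), ENNReal.ofReal (M (Z ω) j ^ a) ∂P =
      (∑' n : ℕ, ENNReal.ofReal (Real.exp (-(lam * T)) * (lam * T) ^ n / n.factorial) *
        (c n * n)) * (ENNReal.ofReal (1 / T) * ∫⁻ ω, (∫⁻ t in Set.Icc 0 T,
          ENNReal.ofReal (max 1 (Real.exp (-(w 1 ω * (T - t)))) ^ a)) ∂P) := by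
    intro a c
    simp_rw [← hNpois]
    exact lintegral_sum_marked hNmeas hVmeas hVid hVlaw hTameas hOS hwmeas hwid hU hw_indep
      (hg a) c
  have hlamT : 0 ≤ lam * T := by positivity
  have hpfin : ∫⁻ ω, (∫⁻ t in Set.Icc 0 T,
      ENNReal.ofReal (max 1 (Real.exp (-(w 1 ω * (T - t)))) ^ p)) ∂P < ⊤ := by
    refine (lintegral_mono fun ω => lintegral_max_exp_rpow_le hp0 (w 1 ω)).trans_lt ?_
    rw [lintegral_mul_const' _ _ ENNReal.ofReal_ne_top]
    exact ENNReal.mul_lt_top hpmom ENNReal.ofReal_lt_top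
  have hαfin : ∫⁻ ω, (∫⁻ t in Set.Icc 0 T,
      ENNReal.ofReal (max 1 (Real.exp (-(w 1 ω * (T - t)))) ^ α)) ∂P < ⊤ := by
    refine (lintegral_mono fun ω => lintegral_mono fun t => ?_).trans_lt hpfin
    exact ENNReal.ofReal_le_ofReal (Real.rpow_le_rpow_of_exponent_le (le_max_left _ _) hp.le)
  -- the common domination and the common limit
  obtain ⟨C, hC, x₀, hx₀, hbound⟩ := hRVX.exists_sum_bound hp
  let b : Ω → ℝ := fun ω => C * ((N ω : ℝ) ^ p * ∑ j ∈ Finset.Icc 1 (N ω), M (Z ω) j ^ p)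
  let L : Ω → ℝ := fun ω => ∑ j ∈ Finset.Icc 1 (N ω), M (Z ω) j ^ α
  have hbint : Integrable b P := by
    refine Integrable.const_mul ?_ C
    have hmeas : Measurable fun ω => (N ω : ℝ) ^ p * ∑ j ∈ Finset.Icc 1 (N ω), M (Z ω) j ^ p :=
      measurable_apply_nat (f := fun n ω => (n : ℝ) ^ p * ∑ j ∈ Finset.Icc 1 n, M (Z ω) j ^ p)
        (fun n => (Finset.measurable_fun_sum _ fun j _ => (hMZ j).pow_const p).const_mul _) hNmeas
    have hnn : ∀ ω j, 0 ≤ M (Z ω) j ^ p := fun ω j => Real.rpow_nonneg (hM0 _ _).le _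
    rw [← lintegral_ofReal_ne_top_iff_integrable hmeas.aestronglyMeasurable
      (Eventually.of_forall fun ω => mul_nonneg (by positivity)
        (Finset.sum_nonneg fun j _ => hnn ω j))]
    have heq : ∀ ω, ENNReal.ofReal ((N ω : ℝ) ^ p * ∑ j ∈ Finset.Icc 1 (N ω), M (Z ω) j ^ p) =
        ENNReal.ofReal ((N ω : ℝ) ^ p) *
          ∑ j ∈ Finset.Icc 1 (N ω), ENNReal.ofReal (M (Z ω) j ^ p) := by
      intro ω
      rw [ENNReal.ofReal_mul (by positivity), ENNReal.ofReal_sum_of_nonneg fun j _ => hnn ω j]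
    simp_rw [heq]
    rw [hmoment p fun n => ENNReal.ofReal ((n : ℝ) ^ p)]
    exact (ENNReal.mul_lt_top (tsum_poisson_rpow_lt_top hlamT p)
      (ENNReal.mul_lt_top ENNReal.ofReal_lt_top hpfin)).ne
  have hL : ∫ ω, L ω ∂P = lam * (T * (P {ω | 0 < w 1 ω}).toReal +
      ∫ ω, (if w 1 ω ≤ 0 then
            (if w 1 ω = 0 then T
              else (1 - Real.exp (-(α * w 1 ω * T))) / (α * w 1 ω))
          else 0) ∂P) := by
    have hnn : ∀ ω j, 0 ≤ M (Z ω) j ^ α := fun ω j => Real.rpow_nonneg (hM0 _ _).le _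
    have hmeas : Measurable L :=
      measurable_apply_nat (f := fun n ω => ∑ j ∈ Finset.Icc 1 n, M (Z ω) j ^ α)
        (fun n => Finset.measurable_fun_sum _ fun j _ => (hMZ j).pow_const α) hNmeas
    set H : Ω → ℝ := fun ω => if w 1 ω ≤ 0 then
            (if w 1 ω = 0 then T
              else (1 - Real.exp (-(α * w 1 ω * T))) / (α * w 1 ω))
          else 0 with hH_def
    have hw1 := hwmeas 1
    have hH : Measurable H := by
      refine Measurable.ite (measurableSet_le hw1 measurable_const) ?_ measurable_const
      refine Measurable.ite (measurableSet_eq_fun hw1 measurable_const) measurable_const ?_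
      fun_prop
    have hH0 : ∀ ω, 0 ≤ H ω := fun ω => ite_elimination_nonneg hT hα (w 1 ω)
    have hpos : MeasurableSet {ω | 0 < w 1 ω} := measurableSet_lt measurable_const hw1
    have hinner : ∀ ω, ∫⁻ t in Set.Icc 0 T,
        ENNReal.ofReal (max 1 (Real.exp (-(w 1 ω * (T - t)))) ^ α) =
        ENNReal.ofReal (({ω | 0 < w 1 ω} : Set Ω).indicator (fun _ => T) ω + H ω) := by
      intro ω
      rw [lintegral_max_exp_rpow hT hα]
      congr 1
      by_cases h : w 1 ω ≤ 0
      · have : ω ∉ {ω | 0 < w 1 ω} := fun h' : 0 < w 1 ω => h.not_gt h'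
        simp [hH_def, h]
      · have h' : 0 < w 1 ω := not_le.1 h
        simp [hH_def, h, h']
    simp_rw [hinner] at hαfin
    have hI0 : ∀ ω, 0 ≤ ({ω | 0 < w 1 ω} : Set Ω).indicator (fun _ => T) ω := fun ω =>
      Set.indicator_nonneg (fun _ _ => hT.le) ω
    have hIm : Measurable (({ω | 0 < w 1 ω} : Set Ω).indicator fun _ => T) :=
      measurable_const.indicator hpos
    have hsumint : Integrable
        (fun ω => ({ω | 0 < w 1 ω} : Set Ω).indicator (fun _ => T) ω + H ω) P :=
      (lintegral_ofReal_ne_top_iff_integrable (hIm.add hH).aestronglyMeasurable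
        (Eventually.of_forall fun ω => add_nonneg (hI0 ω) (hH0 ω))).1 hαfin.ne
    have hIint : Integrable (({ω | 0 < w 1 ω} : Set Ω).indicator fun _ => T) P :=
      (integrable_const T).indicator hpos
    have hHint : Integrable H P := (integrable_add_iff_integrable_right hIint).1 hsumint
    have hLl : ∀ ω, ENNReal.ofReal (L ω) =
        1 * ∑ j ∈ Finset.Icc 1 (N ω), ENNReal.ofReal (M (Z ω) j ^ α) := fun ω => by
      rw [one_mul, ENNReal.ofReal_sum_of_nonneg fun j _ => hnn ω j]
    rw [integral_eq_lintegral_of_nonneg_ae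
      (Eventually.of_forall fun ω => Finset.sum_nonneg fun j _ => hnn ω j)
      hmeas.aestronglyMeasurable]
    rw [lintegral_congr hLl, hmoment α fun _ => 1]
    simp_rw [one_mul, hinner]
    rw [tsum_poisson_mul_self hlamT, ← ofReal_integral_eq_lintegral_ofReal hsumint
      (Eventually.of_forall fun ω => add_nonneg (hI0 ω) (hH0 ω)),
      integral_add hIint hHint, integral_indicator_const _ hpos,
      ← ENNReal.ofReal_mul (by positivity), ← ENNReal.ofReal_mul hlamT,
      ENNReal.toReal_ofReal]
    · simp only [Measure.real, smul_eq_mul]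
      field_simp
    · have : 0 ≤ ∫ ω, H ω ∂P := integral_nonneg hH0
      have : 0 ≤ P.real {ω | 0 < w 1 ω} := measureReal_nonneg
      positivity
  -- sandwich the ruin event between those for the maximum and for the sum
  let Asum : ℝ → Set ((ℕ → ℝ) × ℕ × (ℕ → ℝ) × (ℕ → ℝ) × (ℕ → ℝ)) := fun x =>
    {q | x < ∑ j ∈ Finset.Icc 1 q.2.1, M q.2 j * q.1 j}
  let Amax : ℝ → Set ((ℕ → ℝ) × ℕ × (ℕ → ℝ) × (ℕ → ℝ) × (ℕ → ℝ)) := fun x =>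
    ⋃ j : ℕ, {q | j ∈ Finset.Icc 1 q.2.1} ∩ {q | x < M q.2 j * q.1 j}
  have hterm : ∀ j, Measurable fun q : (ℕ → ℝ) × ℕ × (ℕ → ℝ) × (ℕ → ℝ) × (ℕ → ℝ) =>
      M q.2 j * q.1 j := fun j =>
    ((hM j).comp measurable_snd).mul ((measurable_pi_apply j).comp measurable_fst)
  have hN2 : Measurable fun q : (ℕ → ℝ) × ℕ × (ℕ → ℝ) × (ℕ → ℝ) × (ℕ → ℝ) => q.2.1 :=
    measurable_fst.comp measurable_snd
  have hAsum : ∀ x, MeasurableSet (Asum x) := fun x =>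
    measurableSet_lt measurable_const (measurable_apply_nat
      (f := fun n (q : (ℕ → ℝ) × ℕ × (ℕ → ℝ) × (ℕ → ℝ) × (ℕ → ℝ)) =>
        ∑ j ∈ Finset.Icc 1 n, M q.2 j * q.1 j)
      (fun n => Finset.measurable_fun_sum _ fun j _ => hterm j) hN2)
  have hAmax : ∀ x, MeasurableSet (Amax x) := fun x => MeasurableSet.iUnion fun j =>
    (hN2 (MeasurableSet.of_discrete (s := {n : ℕ | j ∈ Finset.Icc 1 n}))).inter
      (measurableSet_lt measurable_const (hterm j))
  have hmax_sum : ∀ x, Amax x ⊆ Asum x ∪ {q | ∃ j, q.1 j < 0} := by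
    intro x q hq
    by_cases hneg : ∃ j, q.1 j < 0
    · exact Or.inr hneg
    · push Not at hneg
      obtain ⟨j, hj, hlt⟩ := Set.mem_iUnion.1 hq
      refine Or.inl (lt_of_lt_of_le (b := M q.2 j * q.1 j) hlt ?_)
      exact Finset.single_le_sum (f := fun j => M q.2 j * q.1 j)
        (fun i _ => mul_nonneg (hM0 _ _).le (hneg i)) hj
  have hmaxsec : ∀ x ω, {ω' | (U ω', Z ω) ∈ Amax x} =
      ⋃ j ∈ Finset.Icc 1 (N ω), {ω' | x < M (Z ω) j * X j ω'} := by
    intro x ω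
    ext ω'
    simp [Amax, U, Z]
  have hlimsum := tendsto_measureReal_div_of_indepFun hX_indep hU hZ hAsum
    (F := fun x => P.real {ω | x < X 1 ω}) (L := L) (b := b) (fun _ => measureReal_nonneg)
    (fun ω => hRVX.tendsto_sum (θ := M (Z ω)) (Finset.Icc 1 (N ω)) (hone _) (hM0 (Z ω))) (x₀ := x₀)
    (fun x hx ω => by
      have := hbound x hx (Finset.Icc 1 (N ω)) (hone _) (M (Z ω)) (hM1 (Z ω))
      rwa [hcard] at this) hbint
  have hlimmax := tendsto_measureReal_div_of_indepFun hX_indep hU hZ hAmax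
    (F := fun x => P.real {ω | x < X 1 ω}) (L := L) (b := b) (fun _ => measureReal_nonneg)
    (fun ω => by
      simp only [hmaxsec]
      exact hRVX.tendsto_max (θ := M (Z ω)) (Finset.Icc 1 (N ω)) (hone _) (hM0 (Z ω))) (x₀ := x₀)
    (fun x hx ω => by
      have := hbound x hx (Finset.Icc 1 (N ω)) (hone _) (M (Z ω)) (hM1 (Z ω))
      rw [hcard] at this
      refine le_trans (div_le_div_of_nonneg_right (measureReal_mono ?_ (measure_ne_top _ _))
        measureReal_nonneg) this
      intro ω' hω'
      rcases hmax_sum x hω' with h | ⟨j, hj⟩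
      · exact h
      · exact absurd hj (hXnonneg j ω').not_gt) hbint
  rw [← hL]
  refine tendsto_of_tendsto_of_tendsto_of_le_of_le hlimmax hlimsum (fun x => ?_) (fun x => ?_)
  · refine div_le_div_of_nonneg_right (measureReal_mono ?_ (measure_ne_top _ _)) measureReal_nonneg
    intro ω hω
    obtain ⟨j, hj, hlt⟩ := Set.mem_iUnion.1 hω
    exact lt_shotNoise_of_lt_max_mul (X := fun i => X i ω) (w := fun i => w i ω) (t := fun i => Ta i ω)
      (fun i => hXnonneg i ω) hj hlt
  · refine div_le_div_of_nonneg_right (ENNReal.toReal_mono (measure_ne_top _ _)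
      (measure_mono_ae ?_)) measureReal_nonneg
    filter_upwards [ae_arrivals_monotone hVid hVlaw hOS] with ω hω hlt
    exact lt_of_lt_of_le hlt (shotNoise_le_sum (X := fun i => X i ω) (w := fun i => w i ω)
      (t := fun i => Ta i ω) (fun i => hXnonneg i ω) hω)
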